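/- Let σ ∈ {1,2}. (i) There is a constant C > 0 such that for every x ∈ ℤ with ∓x ≥ 0, the Fourier coefficients of the 2π-periodic matrix-valued function ξ ↦ (A_{ξ,±})^x satisfy Σ_{n∈ℤ} ⟨n⟩^{σ−1}·‖((A_{·,±})^x)^∧(n)‖ ≤ C·⟨x⟩^σ, where f^∧(n) := (2π)⁻¹∫_{−π}^{π} f(ξ)e^{−inξ}dξ. (ii) If Σ_{x∈ℤ}⟨x⟩^σ(|α(x)−α₀| + |θ(x)|) < ∞, then Σ_{x∈ℤ} ⟨x⟩^σ · Σ_{n∈ℤ} ⟨n⟩^{σ−1}·‖(V_{·,±}(x))^∧(n)‖ < ∞, where V_{ξ,±}(x) := e^{∓iξ}·(T_{λ(ξ)}(x+1) − T_{0,λ(ξ)}). -/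

import Mathlib

open Complex Matrix

noncomputable section

/-- The coin matrix `C_{α,β,θ} = e^{iθ}[[β, conj α],[−α, conj β]]`. -/
def coinMat (a b : ℂ) (t : ℝ) : Matrix (Fin 2) (Fin 2) ℂ :=
  Complex.exp ((t : ℂ) * Complex.I) • !![b, (starRingEnd ℂ) a; -a, (starRingEnd ℂ) b]

/-- The quantum walk evolution operator `U = SĈ`, acting on arbitrary `u : ℤ → ℂ²`:
`(Uu)↑(x) = (C(x−1)u(x−1))↑`, `(Uu)↓(x) = (C(x+1)u(x+1))↓`. -/
def qw (C : ℤ → Matrix (Fin 2) (Fin 2) ℂ) (u : ℤ → Fin 2 → ℂ) : ℤ → Fin 2 → ℂ :=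
  fun x => ![(C (x - 1)).mulVec (u (x - 1)) 0, (C (x + 1)).mulVec (u (x + 1)) 1]

/-- `ρ = √(1−|a|²)`. -/
def rho (a : ℂ) : ℝ := Real.sqrt (1 - ‖a‖ ^ 2)

/-- The coin map `x ↦ C_{α(x), ρ(x), θ(x)}`. -/
def coinOf (α : ℤ → ℂ) (θ : ℤ → ℝ) : ℤ → Matrix (Fin 2) (Fin 2) ℂ :=
  fun x => coinMat (α x) ((rho (α x) : ℝ) : ℂ) (θ x)

/-- The transfer matrix `T_λ(x)`. -/
def Tmat (α : ℤ → ℂ) (θ : ℤ → ℝ) (lam : ℂ) (x : ℤ) : Matrix (Fin 2) (Fin 2) ℂ :=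
  (((rho (α x) : ℝ) : ℂ))⁻¹ •
    !![Complex.exp (Complex.I * (lam - (θ x : ℂ))), α x;
       (starRingEnd ℂ) (α x), Complex.exp (-(Complex.I * (lam - (θ x : ℂ))))]

/-- `(J_VE u)(x) = (u↓(x−1), u↑(x))`. -/
def Jve (u : ℤ → Fin 2 → ℂ) : ℤ → Fin 2 → ℂ := fun x => ![u (x - 1) 1, u x 0]

/-- `(J_EV v)(x) = (v↓(x), v↑(x+1))`, the inverse of `J_VE`. -/
def Jev (v : ℤ → Fin 2 → ℂ) : ℤ → Fin 2 → ℂ := fun x => ![v x 1, v (x + 1) 0]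

/-- Determinant of the 2×2 matrix with columns `v, w`. -/
def det2 (v w : Fin 2 → ℂ) : ℂ := v 0 * w 1 - v 1 * w 0

/-- The Euclidean norm on ℂ². -/
def nrm2 (v : Fin 2 → ℂ) : ℝ := Real.sqrt (‖v 0‖ ^ 2 + ‖v 1‖ ^ 2)

/-- Membership in `l²(ℤ, ℂ²)`. -/
def MemL2 (u : ℤ → Fin 2 → ℂ) : Prop := Summable fun x : ℤ => ‖u x 0‖ ^ 2 + ‖u x 1‖ ^ 2

/-- The Japanese bracket `⟨x⟩ = √(1+x²)`. -/
def jp (x : ℤ) : ℝ := Real.sqrt (1 + (x : ℝ) ^ 2)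

/-- The free transfer matrix `T_{0,λ}` (for real `λ`). -/
def T0m (a0 : ℂ) (lam : ℝ) : Matrix (Fin 2) (Fin 2) ℂ :=
  (((rho a0 : ℝ) : ℂ))⁻¹ •
    !![Complex.exp (Complex.I * (lam : ℂ)), a0;
       (starRingEnd ℂ) a0, Complex.exp (-(Complex.I * (lam : ℂ)))]

/-- `λ(ξ) = arccos(ρ₀ cos ξ) ∈ [0,π]`. -/
def lamOf (a0 : ℂ) (ξ : ℝ) : ℝ := Real.arccos (rho a0 * Real.cos ξ)

/-- `A_{ξ,±} = e^{∓iξ}T_{0,λ(ξ)}`; `ε = 1` is the `+` case, `ε = −1` the `−` case. -/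
def Amat (a0 : ℂ) (ε : ℝ) (ξ : ℝ) : Matrix (Fin 2) (Fin 2) ℂ :=
  Complex.exp (-(((ε * ξ : ℝ) : ℂ) * Complex.I)) • T0m a0 (lamOf a0 ξ)

/-- Integer powers of a matrix: for negative exponents, powers of the inverse matrix. -/
def mzpow (A : Matrix (Fin 2) (Fin 2) ℂ) (x : ℤ) : Matrix (Fin 2) (Fin 2) ℂ :=
  if 0 ≤ x then A ^ x.toNat else A⁻¹ ^ (-x).toNat

/-- The operator norm on `ℂ²` of a 2×2 matrix. -/
def opN (A : Matrix (Fin 2) (Fin 2) ℂ) : ℝ := ‖Matrix.toEuclideanCLM (𝕜 := ℂ) A‖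

/-- The `n`-th Fourier coefficient of a 2π-periodic matrix-valued function,
`f^∧(n) = (2π)⁻¹∫_{−π}^{π} f(ξ)e^{−inξ}dξ`, computed entrywise. -/
def fcoefM (f : ℝ → Matrix (Fin 2) (Fin 2) ℂ) (n : ℤ) : Matrix (Fin 2) (Fin 2) ℂ :=
  Matrix.of fun i j : Fin 2 =>
    ((2 * Real.pi : ℝ) : ℂ)⁻¹ *
      ∫ ξ in (-Real.pi)..Real.pi, f ξ i j * Complex.exp (-((n : ℂ) * (ξ : ℂ) * Complex.I))

/-- `V_{ξ,±}(x) = e^{∓iξ}(T_{λ(ξ)}(x+1) − T_{0,λ(ξ)})`; `ε = ±1`. -/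
def Vmat (α : ℤ → ℂ) (θ : ℤ → ℝ) (a0 : ℂ) (ε : ℝ) (ξ : ℝ) (x : ℤ) :
    Matrix (Fin 2) (Fin 2) ℂ :=
  Complex.exp (-(((ε * ξ : ℝ) : ℂ) * Complex.I)) •
    (Tmat α θ ((lamOf a0 ξ : ℝ) : ℂ) (x + 1) - T0m a0 (lamOf a0 ξ))

open scoped ContDiff

/-- The `n`-th Fourier coefficient of a scalar function on `[-π, π]`. -/
def fcoef (f : ℝ → ℂ) (n : ℤ) : ℂ :=
  ((2 * Real.pi : ℝ) : ℂ)⁻¹ *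
    ∫ ξ in (-Real.pi)..Real.pi, f ξ * Complex.exp (-((n : ℂ) * (ξ : ℂ) * Complex.I))

theorem fcoef_add {f g : ℝ → ℂ} (hf : Continuous f) (hg : Continuous g) (n : ℤ) :
    fcoef (fun ξ => f ξ + g ξ) n = fcoef f n + fcoef g n := by
  unfold fcoef
  rw [← mul_add, ← intervalIntegral.integral_add]
  · simp only [add_mul]
  all_goals exact Continuous.intervalIntegrable (by fun_prop) _ _

theorem fcoef_const_mul (c : ℂ) (f : ℝ → ℂ) (n : ℤ) :
    fcoef (fun ξ => c * f ξ) n = c * fcoef f n := by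
  unfold fcoef
  simp only [mul_assoc, intervalIntegral.integral_const_mul]
  ring

theorem fcoef_exp_mul (k : ℤ) (f : ℝ → ℂ) (n : ℤ) :
    fcoef (fun ξ => Complex.exp ((k : ℂ) * (ξ : ℂ) * Complex.I) * f ξ) n = fcoef f (n - k) := by
  unfold fcoef
  congr 2
  ext ξ
  have : Complex.exp (-(((n - k : ℤ) : ℂ) * (ξ : ℂ) * Complex.I)) =
      Complex.exp ((k : ℂ) * (ξ : ℂ) * Complex.I) *
        Complex.exp (-((n : ℂ) * (ξ : ℂ) * Complex.I)) := by
    rw [← Complex.exp_add]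
    push_cast
    ring_nf
  rw [this]
  ring

theorem fcoef_deriv {f : ℝ → ℂ} (hf : ContDiff ℝ ∞ f) (hp : Function.Periodic f (2 * Real.pi))
    (n : ℤ) : fcoef (deriv f) n = (n : ℂ) * Complex.I * fcoef f n := by
  have hd : ∀ ξ : ℝ, HasDerivAt
      (fun ξ : ℝ => f ξ * Complex.exp (-((n : ℂ) * (ξ : ℂ) * Complex.I)))
      (deriv f ξ * Complex.exp (-((n : ℂ) * (ξ : ℂ) * Complex.I)) -
        (n : ℂ) * Complex.I * (f ξ * Complex.exp (-((n : ℂ) * (ξ : ℂ) * Complex.I)))) ξ := by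
    intro ξ
    have h1 := (hf.differentiable (by simp) ξ).hasDerivAt
    have h2 : HasDerivAt (fun ξ : ℝ => -((n : ℂ) * (ξ : ℂ) * Complex.I)) (-((n : ℂ) * Complex.I))
        ξ := by
      simpa using (((Complex.ofRealCLM.hasDerivAt (x := ξ)).const_mul (n : ℂ)).mul_const
        Complex.I).fun_neg
    exact (h1.mul h2.cexp).congr_deriv (by ring)
  have hc : Continuous f := hf.continuous
  have hc' : Continuous (deriv f) := hf.continuous_deriv (by simp)
  have hend : f Real.pi * Complex.exp (-((n : ℂ) * (Real.pi : ℂ) * Complex.I)) =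
      f (-Real.pi) * Complex.exp (-((n : ℂ) * ((-Real.pi : ℝ) : ℂ) * Complex.I)) := by
    have h1 : f Real.pi = f (-Real.pi) := by
      rw [← hp (-Real.pi)]
      ring_nf
    rw [h1]
    congr 1
    rw [Complex.exp_eq_exp_iff_exists_int]
    refine ⟨-n, ?_⟩
    push_cast
    ring
  have hint := intervalIntegral.integral_eq_sub_of_hasDerivAt (a := -Real.pi) (b := Real.pi)
    (fun ξ _ => hd ξ) (Continuous.intervalIntegrable (by fun_prop) _ _)
  rw [hend, sub_self, intervalIntegral.integral_sub, intervalIntegral.integral_const_mul,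
    sub_eq_zero] at hint
  · unfold fcoef
    rw [hint]
    ring
  all_goals exact Continuous.intervalIntegrable (by fun_prop) _ _

theorem norm_fcoef_le (f : ℝ → ℂ) (n : ℤ) :
    ‖fcoef f n‖ ≤ (2 * Real.pi)⁻¹ * ∫ ξ in (-Real.pi)..Real.pi, ‖f ξ‖ := by
  unfold fcoef
  rw [norm_mul, norm_inv, Complex.norm_real, Real.norm_of_nonneg (by positivity)]
  gcongr
  refine (intervalIntegral.norm_integral_le_integral_norm (by linarith [Real.pi_pos])).trans_eq ?_
  congr 1
  ext ξ
  rw [norm_mul, show -((n : ℂ) * (ξ : ℂ) * Complex.I) = ((-(n * ξ) : ℝ) : ℂ) * Complex.I by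
    push_cast; ring, Complex.norm_exp_ofReal_mul_I, mul_one]

theorem Function.Periodic.deriv {f : ℝ → ℂ} {c : ℝ} (hp : Function.Periodic f c) :
    Function.Periodic (deriv f) c := by
  intro x
  rw [← deriv_comp_add_const, funext hp]

theorem one_le_jp (n : ℤ) : 1 ≤ jp n := by
  unfold jp
  rw [Real.one_le_sqrt]
  nlinarith [sq_nonneg (n : ℝ)]

theorem jp_le (n : ℤ) : jp n ≤ 1 + |(n : ℝ)| := by
  unfold jp
  rw [Real.sqrt_le_left (by positivity)]
  nlinarith [sq_abs (n : ℝ), abs_nonneg (n : ℝ)]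

theorem jp_add_le (n k : ℤ) : jp (n + k) ≤ 2 * jp k * jp n := by
  unfold jp
  rw [Real.sqrt_le_left (by positivity), mul_pow, mul_pow, Real.sq_sqrt (by positivity),
    Real.sq_sqrt (by positivity)]
  push_cast
  nlinarith [sq_nonneg ((n : ℝ) - k), sq_nonneg ((n : ℝ) * k)]

theorem jp_two_mul_le (n : ℤ) : jp (2 * n) ≤ 2 * jp n := by
  unfold jp
  rw [Real.sqrt_le_left (by positivity), mul_pow, Real.sq_sqrt (by positivity)]
  push_cast
  linarith

theorem jp_add_pow_le {s : ℕ} (n k : ℤ) :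
    jp (n + k) ^ s ≤ 2 ^ s * jp k ^ s * jp n ^ s := by
  rw [← mul_pow, ← mul_pow]
  have := one_le_jp (n + k)
  gcongr
  exact jp_add_le n k

theorem jp_mono {m n : ℤ} (h : |m| ≤ |n|) : jp m ≤ jp n := by
  have : |(m : ℝ)| ≤ |(n : ℝ)| := by exact_mod_cast h
  unfold jp
  gcongr 1
  nlinarith [sq_abs (m : ℝ), sq_abs (n : ℝ), abs_nonneg (m : ℝ)]

/-- `f` is continuous and its weighted Wiener norm `∑ ⟨n⟩ˢ ‖f^∧(n)‖` is finite, at most `K`. -/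
structure WienerBound (s : ℕ) (f : ℝ → ℂ) (K : ℝ) : Prop where
  cont : Continuous f
  summable : Summable fun n : ℤ => jp n ^ s * ‖fcoef f n‖
  tsum_le : ∑' n : ℤ, jp n ^ s * ‖fcoef f n‖ ≤ K

theorem jp_pow_nonneg (s : ℕ) (n : ℤ) : 0 ≤ jp n ^ s :=
  pow_nonneg (zero_le_one.trans (one_le_jp n)) s

namespace WienerBound

variable {s : ℕ} {f g : ℝ → ℂ} {K L : ℝ}

theorem nonneg (hf : WienerBound s f K) : 0 ≤ K :=
  (tsum_nonneg fun n => mul_nonneg (jp_pow_nonneg s n) (norm_nonneg _)).trans hf.tsum_le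

theorem of_le {b : ℤ → ℝ} (hf : Continuous f) (hb : Summable b)
    (hle : ∀ n, jp n ^ s * ‖fcoef f n‖ ≤ b n) (hK : ∑' n, b n ≤ K) : WienerBound s f K := by
  have hs : Summable fun n : ℤ => jp n ^ s * ‖fcoef f n‖ :=
    hb.of_nonneg_of_le (fun n => mul_nonneg (jp_pow_nonneg s n) (norm_nonneg _)) hle
  exact ⟨hf, hs, (hs.tsum_le_tsum hle hb).trans hK⟩

theorem add (hf : WienerBound s f K) (hg : WienerBound s g L) :
    WienerBound s (fun ξ => f ξ + g ξ) (K + L) := by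
  refine of_le (hf.cont.add hg.cont) (hf.summable.add hg.summable) (fun n => ?_) ?_
  · rw [fcoef_add hf.cont hg.cont, ← mul_add]
    exact mul_le_mul_of_nonneg_left (norm_add_le _ _) (jp_pow_nonneg s n)
  · rw [hf.summable.tsum_add hg.summable]
    exact add_le_add hf.tsum_le hg.tsum_le

theorem const_mul (c : ℂ) (hf : WienerBound s f K) :
    WienerBound s (fun ξ => c * f ξ) (‖c‖ * K) := by
  refine of_le (hf.cont.const_mul c) (hf.summable.mul_left ‖c‖) (fun n => ?_) ?_
  · rw [fcoef_const_mul, norm_mul, mul_left_comm]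
  · rw [tsum_mul_left]
    exact mul_le_mul_of_nonneg_left hf.tsum_le (norm_nonneg c)

theorem exp_mul (k : ℤ) (hf : WienerBound s f K) :
    WienerBound s (fun ξ => Complex.exp ((k : ℂ) * (ξ : ℂ) * Complex.I) * f ξ)
      (2 ^ s * jp k ^ s * K) := by
  have hfc := hf.cont
  refine of_le (b := fun n => 2 ^ s * jp k ^ s * (jp (n - k) ^ s * ‖fcoef f (n - k)‖))
    (by fun_prop) ?_ (fun n => ?_) ?_
  · exact ((Equiv.subRight k).summable_iff.2 hf.summable).mul_left _
  · rw [fcoef_exp_mul, ← mul_assoc]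
    gcongr
    simpa using jp_add_pow_le (s := s) (n - k) k
  · rw [tsum_mul_left]
    exact mul_le_mul_of_nonneg_left
      (((Equiv.subRight k).tsum_eq fun n => jp n ^ s * ‖fcoef f n‖).trans_le hf.tsum_le)
      (mul_nonneg (by positivity) (jp_pow_nonneg s k))

theorem zero : WienerBound s (fun _ => 0) 0 := by
  refine of_le (b := fun _ => 0) continuous_const summable_zero (fun n => ?_) (by simp)
  simp [fcoef]

theorem mono (hf : WienerBound s f K) (h : K ≤ L) : WienerBound s f L :=
  ⟨hf.cont, hf.summable, hf.tsum_le.trans h⟩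

/-- Multiplication by the geometric sum `∑_{k<N} e^{2ikξ}` costs a factor of order `⟨N⟩ˢ⁺¹`. -/
theorem geom_sum_mul (hf : WienerBound s f K) (N : ℕ) :
    WienerBound s
      (fun ξ => (∑ k ∈ Finset.range N, Complex.exp (2 * (ξ : ℂ) * Complex.I) ^ k) * f ξ)
      (N * (4 ^ s * jp N ^ s * K)) := by
  suffices h : ∀ M ≤ N, WienerBound s
      (fun ξ => (∑ k ∈ Finset.range M, Complex.exp (2 * (ξ : ℂ) * Complex.I) ^ k) * f ξ)
      (M * (4 ^ s * jp N ^ s * K)) from h N le_rfl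
  intro M hM
  induction M with
  | zero => simpa using zero
  | succ M ih =>
    have hjp : jp (2 * M) ^ s ≤ 2 ^ s * jp N ^ s := by
      rw [← mul_pow]
      have := one_le_jp (2 * M)
      gcongr
      exact (jp_two_mul_le M).trans (by gcongr; exact jp_mono (by simp; omega))
    have hK := hf.nonneg
    have hterm := (hf.exp_mul (2 * M)).mono (L := 4 ^ s * jp N ^ s * K) <| by
      calc 2 ^ s * jp (2 * M) ^ s * K ≤ 2 ^ s * (2 ^ s * jp N ^ s) * K := by gcongr
        _ = 4 ^ s * jp N ^ s * K := by rw [← mul_assoc, ← mul_pow]; norm_num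
    convert (ih (by omega)).add hterm using 1
    · ext ξ
      rw [Finset.sum_range_succ, add_mul, ← Complex.exp_nat_mul]
      push_cast
      ring_nf
    · push_cast
      ring

end WienerBound

theorem ContDiff.wienerBound {s : ℕ} (hs : s ≤ 1) {f : ℝ → ℂ} (hf : ContDiff ℝ ∞ f)
    (hp : Function.Periodic f (2 * Real.pi)) : ∃ K, WienerBound s f K := by
  have hf1 : ContDiff ℝ ∞ (deriv f) := (contDiff_infty_iff_deriv.1 hf).2
  have hf2 : ContDiff ℝ ∞ (deriv (deriv f)) := (contDiff_infty_iff_deriv.1 hf1).2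
  set M := (2 * Real.pi)⁻¹ * ∫ ξ in (-Real.pi)..Real.pi, ‖deriv (deriv (deriv f)) ξ‖ with hM
  have hb : ∀ n : ℤ, |(n : ℝ)| ^ 3 * ‖fcoef f n‖ ≤ M := by
    intro n
    have h := norm_fcoef_le (deriv (deriv (deriv f))) n
    rw [fcoef_deriv hf2 hp.deriv.deriv, fcoef_deriv hf1 hp.deriv, fcoef_deriv hf hp] at h
    simp only [norm_mul, Complex.norm_I, Complex.norm_intCast, mul_one] at h
    calc _ = _ := by ring
      _ ≤ _ := h
  refine ⟨_, hf.continuous, ?_, le_rfl⟩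
  have h2 : Summable fun n : ℤ => 2 * M * (1 / (n : ℝ) ^ 2) :=
    (Real.summable_one_div_int_pow.2 one_lt_two).mul_left _
  refine Summable.of_norm_bounded_eventually h2 ?_
  filter_upwards [(Set.finite_singleton (0 : ℤ)).compl_mem_cofinite] with n hn
  have hn1 : 1 ≤ |(n : ℝ)| := by exact_mod_cast Int.one_le_abs hn
  rw [Real.norm_of_nonneg (mul_nonneg (jp_pow_nonneg s n) (norm_nonneg _)), ← sq_abs (n : ℝ),
    mul_one_div, le_div_iff₀ (by positivity)]
  have h3 : jp n ^ s ≤ 2 * |(n : ℝ)| :=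
    (pow_le_pow_right₀ (one_le_jp n) hs).trans (by linarith [jp_le n, pow_one (jp n)])
  calc jp n ^ s * ‖fcoef f n‖ * |(n : ℝ)| ^ 2
      ≤ 2 * |(n : ℝ)| * ‖fcoef f n‖ * |(n : ℝ)| ^ 2 := by gcongr
    _ = 2 * (|(n : ℝ)| ^ 3 * ‖fcoef f n‖) := by ring
    _ ≤ 2 * M := by gcongr; exact hb n

theorem opN_le_sum (A : Matrix (Fin 2) (Fin 2) ℂ) : opN A ≤ ∑ i, ∑ j, ‖A i j‖ := by
  refine ContinuousLinearMap.opNorm_le_bound _ (by positivity) fun v => ?_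
  have hw : ∀ w : EuclideanSpace ℂ (Fin 2), ‖w‖ ≤ ∑ i, ‖w i‖ := by
    intro w
    rw [EuclideanSpace.norm_eq, Real.sqrt_le_left (by positivity)]
    simp only [Fin.sum_univ_two]
    nlinarith [mul_nonneg (norm_nonneg (w 0)) (norm_nonneg (w 1))]
  refine (hw _).trans ?_
  rw [Finset.sum_mul]
  gcongr with i
  rw [Matrix.ofLp_toEuclideanCLM, Matrix.mulVec, dotProduct, Finset.sum_mul]
  refine norm_sum_le_of_le _ fun j _ => ?_
  rw [norm_mul]
  gcongr
  exact PiLp.norm_apply_le v j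

theorem summable_opN_and_tsum_le {s : ℕ} {F : ℝ → Matrix (Fin 2) (Fin 2) ℂ}
    {K : Fin 2 → Fin 2 → ℝ} (h : ∀ i j, WienerBound s (fun ξ => F ξ i j) (K i j)) :
    Summable (fun n : ℤ => jp n ^ s * opN (fcoefM F n)) ∧
      ∑' n : ℤ, jp n ^ s * opN (fcoefM F n) ≤ ∑ i, ∑ j, K i j := by
  have hle : ∀ n : ℤ, jp n ^ s * opN (fcoefM F n) ≤
      ∑ i, ∑ j, jp n ^ s * ‖fcoef (fun ξ => F ξ i j) n‖ := by
    intro n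
    simp only [← Finset.mul_sum]
    exact mul_le_mul_of_nonneg_left (opN_le_sum _) (jp_pow_nonneg s n)
  have hsum : Summable fun n : ℤ => ∑ i, ∑ j, jp n ^ s * ‖fcoef (fun ξ => F ξ i j) n‖ :=
    summable_sum fun i _ => summable_sum fun j _ => (h i j).summable
  have hs := hsum.of_nonneg_of_le
    (fun n => mul_nonneg (jp_pow_nonneg s n) (norm_nonneg _)) hle
  refine ⟨hs, (hs.tsum_le_tsum hle hsum).trans ?_⟩
  rw [Summable.tsum_finsetSum fun i _ => summable_sum fun j _ => (h i j).summable]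
  gcongr with i
  rw [Summable.tsum_finsetSum fun j _ => (h i j).summable]
  gcongr with j
  exact (h i j).tsum_le


theorem pow_eq_geom_sum {R A : Type*} [CommRing R] [Ring A] [Algebra R A] (B : A) (z : R)
    (hB : (B - 1) * B = z • (B - 1)) (N : ℕ) :
    B ^ N = (∑ k ∈ Finset.range N, z ^ k) • (B - 1) + 1 := by
  have h : ∀ k, (B - 1) * B ^ k = z ^ k • (B - 1) := by
    intro k
    induction k with
    | zero => simp
    | succ k ih => rw [pow_succ, ← mul_assoc, ih, smul_mul_assoc, hB, smul_smul, pow_succ]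
  rw [Finset.sum_smul, ← sub_eq_iff_eq_add, ← mul_geom_sum, Finset.mul_sum]
  simp only [h]

theorem smul_sub_one_mul_self {M : Matrix (Fin 2) (Fin 2) ℂ} (ξ : ℝ) (hdet : M.det = 1)
    (htr : M.trace = 2 * Complex.cos ξ) :
    (Complex.exp (ξ * Complex.I) • M - 1) * Complex.exp (ξ * Complex.I) • M =
      Complex.exp (2 * (ξ : ℂ) * Complex.I) • (Complex.exp (ξ * Complex.I) • M - 1) := by
  have hz : Complex.exp (2 * (ξ : ℂ) * Complex.I) = Complex.exp (ξ * Complex.I) ^ 2 := by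
    rw [← Complex.exp_nat_mul]
    push_cast
    ring_nf
  have hcos : Complex.exp (ξ * Complex.I) * (2 * Complex.cos ξ) =
      Complex.exp (ξ * Complex.I) ^ 2 + 1 := by
    rw [Complex.two_cos, mul_add, neg_mul, ← Complex.exp_add _ (-_), add_neg_cancel,
      Complex.exp_zero, sq]
  rw [hz]
  set w := Complex.exp (ξ * Complex.I)
  rw [← htr, Matrix.trace_fin_two] at hcos
  rw [Matrix.det_fin_two] at hdet
  ext i j
  fin_cases i <;> fin_cases j <;> simp [Matrix.mul_apply, Fin.sum_univ_two]
  · linear_combination w * M 0 0 * hcos - w ^ 2 * hdet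
  · linear_combination w * M 0 1 * hcos
  · linear_combination w * M 1 0 * hcos
  · linear_combination w * M 1 1 * hcos - w ^ 2 * hdet

/-- Powers of a unimodular smooth periodic matrix function with eigenvalues `1, e^{2iξ}` grow at
most like `⟨N⟩ˢ⁺¹` in the weighted Wiener norm. -/
theorem exists_tsum_pow_le {s : ℕ} (hs : s ≤ 1) {M : ℝ → Matrix (Fin 2) (Fin 2) ℂ}
    (hM : ∀ i j, ContDiff ℝ ∞ fun ξ => M ξ i j)
    (hp : Function.Periodic M (2 * Real.pi)) (hdet : ∀ ξ, (M ξ).det = 1)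
    (htr : ∀ ξ : ℝ, (M ξ).trace = 2 * Complex.cos ξ) :
    ∃ C : ℝ, 0 < C ∧ ∀ N : ℕ,
      Summable (fun n : ℤ =>
        jp n ^ s * opN (fcoefM (fun ξ => (Complex.exp (ξ * Complex.I) • M ξ) ^ N) n)) ∧
      ∑' n : ℤ, jp n ^ s * opN (fcoefM (fun ξ => (Complex.exp (ξ * Complex.I) • M ξ) ^ N) n)
        ≤ C * jp N ^ (s + 1) := by
  have hK : ∀ i j, ∃ K, WienerBound s
      (fun ξ : ℝ => (Complex.exp (ξ * Complex.I) • M ξ - 1) i j) K := by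
    intro i j
    refine ContDiff.wienerBound hs ?_ fun ξ => ?_
    · simp only [Matrix.sub_apply, Matrix.smul_apply, smul_eq_mul]
      have := hM i j
      have : ContDiff ℝ ∞ Complex.ofReal := Complex.ofRealCLM.contDiff
      fun_prop
    · have he : Complex.exp ((ξ + 2 * Real.pi : ℝ) * Complex.I) = Complex.exp (ξ * Complex.I) := by
        rw [← Complex.exp_periodic (ξ * Complex.I)]
        push_cast
        ring_nf
      simp only [he, hp ξ]
  choose K hK using hK
  have hL : ∀ i j, ∃ L, WienerBound s (fun _ : ℝ => (1 : Matrix (Fin 2) (Fin 2) ℂ) i j) L :=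
    fun i j => ContDiff.wienerBound hs contDiff_const fun _ => rfl
  choose L hL using hL
  have hK0 := fun i j => (hK i j).nonneg
  have hL0 := fun i j => (hL i j).nonneg
  refine ⟨∑ i, ∑ j, (4 ^ s * K i j + L i j) + 1, ?_, fun N => ?_⟩
  · have : 0 ≤ ∑ i, ∑ j, (4 ^ s * K i j + L i j) := Finset.sum_nonneg fun i _ =>
      Finset.sum_nonneg fun j _ => by have := hK0 i j; have := hL0 i j; positivity
    linarith
  have hbound : ∀ i j, WienerBound s
      (fun ξ : ℝ => ((Complex.exp (ξ * Complex.I) • M ξ) ^ N) i j)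
      ((4 ^ s * K i j + L i j) * jp N ^ (s + 1)) := by
    intro i j
    have hN : (N : ℝ) ≤ jp N := Real.le_sqrt_of_sq_le (by push_cast; linarith)
    have h1 : 1 ≤ jp N ^ (s + 1) := one_le_pow₀ (one_le_jp _)
    have h2 := jp_pow_nonneg s N
    have h3 := hK0 i j
    have h4 := hL0 i j
    have hb := (((hK i j).geom_sum_mul N).add (hL i j)).mono
      (L := (4 ^ s * K i j + L i j) * jp N ^ (s + 1)) <| by
        calc N * (4 ^ s * jp N ^ s * K i j) + L i j
            ≤ jp N * (4 ^ s * jp N ^ s * K i j) + L i j * jp N ^ (s + 1) := by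
              gcongr
              exact le_mul_of_one_le_right h4 h1
          _ = (4 ^ s * K i j + L i j) * jp N ^ (s + 1) := by ring
    convert hb using 2 with ξ
    rw [pow_eq_geom_sum _ _ (smul_sub_one_mul_self ξ (hdet ξ) (htr ξ))]
    rfl
  obtain ⟨h1, h2⟩ := summable_opN_and_tsum_le hbound
  refine ⟨h1, h2.trans ?_⟩
  simp only [← Finset.sum_mul]
  have := jp_pow_nonneg (s + 1) N
  gcongr
  linarith

section FreeTransfer

variable {a : ℂ}

theorem rho_pos (ha : ‖a‖ < 1) : 0 < rho a :=
  Real.sqrt_pos.2 (by nlinarith [norm_nonneg a])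

theorem rho_lt_one (ha : 0 < ‖a‖) : rho a < 1 := by
  unfold rho
  rw [Real.sqrt_lt' one_pos]
  nlinarith

theorem abs_rho_mul_cos_lt_one (h₀ : 0 < ‖a‖) (h₁ : ‖a‖ < 1) (ξ : ℝ) :
    |rho a * Real.cos ξ| < 1 := by
  rw [abs_mul, abs_of_pos (rho_pos h₁)]
  nlinarith [Real.abs_cos_le_one ξ, rho_lt_one h₀, rho_pos h₁, abs_nonneg (Real.cos ξ)]

theorem contDiff_lamOf (h₀ : 0 < ‖a‖) (h₁ : ‖a‖ < 1) : ContDiff ℝ ∞ (lamOf a) := by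
  rw [contDiff_iff_contDiffAt]
  intro ξ
  have h := abs_lt.1 (abs_rho_mul_cos_lt_one h₀ h₁ ξ)
  exact (Real.contDiffAt_arccos h.1.ne' h.2.ne).comp ξ
    (f := fun ξ => rho a * Real.cos ξ) (by fun_prop)

theorem lamOf_periodic (a : ℂ) : Function.Periodic (lamOf a) (2 * Real.pi) := fun ξ => by
  simp [lamOf]

theorem cos_lamOf (h₀ : 0 < ‖a‖) (h₁ : ‖a‖ < 1) (ξ : ℝ) :
    Real.cos (lamOf a ξ) = rho a * Real.cos ξ := by
  have h := abs_lt.1 (abs_rho_mul_cos_lt_one h₀ h₁ ξ)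
  exact Real.cos_arccos h.1.le h.2.le

theorem contDiff_T0m (h₀ : 0 < ‖a‖) (h₁ : ‖a‖ < 1) (i j : Fin 2) :
    ContDiff ℝ ∞ fun ξ => T0m a (lamOf a ξ) i j := by
  have h := contDiff_lamOf h₀ h₁
  have hc : ContDiff ℝ ∞ Complex.ofReal := Complex.ofRealCLM.contDiff
  fin_cases i <;> fin_cases j <;> simp [T0m] <;> fun_prop

theorem det_T0m (h₁ : ‖a‖ < 1) (l : ℝ) : (T0m a l).det = 1 := by
  have hρ : ((rho a : ℝ) : ℂ) ≠ 0 := by exact_mod_cast (rho_pos h₁).ne'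
  have hsq : ((rho a : ℝ) : ℂ) ^ 2 = 1 - a * (starRingEnd ℂ) a := by
    rw [Complex.mul_conj, Complex.normSq_eq_norm_sq]
    have : rho a ^ 2 = 1 - ‖a‖ ^ 2 := Real.sq_sqrt (by nlinarith [norm_nonneg a])
    exact_mod_cast this
  rw [T0m, Matrix.det_smul, Matrix.det_fin_two_of, ← Complex.exp_add, add_neg_cancel,
    Complex.exp_zero, Fintype.card_fin, ← hsq, ← mul_pow, inv_mul_cancel₀ hρ, one_pow]

theorem trace_T0m_lamOf (h₀ : 0 < ‖a‖) (h₁ : ‖a‖ < 1) (ξ : ℝ) :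
    (T0m a (lamOf a ξ)).trace = 2 * Complex.cos ξ := by
  have hρ : ((rho a : ℝ) : ℂ) ≠ 0 := by exact_mod_cast (rho_pos h₁).ne'
  have hcos : Complex.cos (lamOf a ξ) = rho a * Complex.cos ξ := by
    exact_mod_cast cos_lamOf h₀ h₁ ξ
  have htwo := Complex.two_cos (lamOf a ξ : ℂ)
  rw [hcos] at htwo
  simp only [T0m, Matrix.trace_smul, Matrix.trace_fin_two_of, smul_eq_mul]
  rw [inv_mul_eq_iff_eq_mul₀ hρ, mul_comm Complex.I, ← neg_mul, ← htwo]
  ring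

theorem Amat_neg_one (a : ℂ) (ξ : ℝ) :
    Amat a (-1) ξ = Complex.exp (ξ * Complex.I) • T0m a (lamOf a ξ) := by
  simp [Amat]

theorem inv_Amat_one (h₁ : ‖a‖ < 1) (ξ : ℝ) :
    (Amat a 1 ξ)⁻¹ = Complex.exp (ξ * Complex.I) • (T0m a (lamOf a ξ)).adjugate := by
  refine Matrix.inv_eq_right_inv ?_
  rw [Amat, smul_mul_smul_comm, Matrix.mul_adjugate, det_T0m h₁, one_smul, ← Complex.exp_add]
  simp

end FreeTransfer

section Perturbation

open Asymptotics

theorem isBigO_inv_rho_sub {a₀ : ℂ} (h₁ : ‖a₀‖ < 1) :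
    (fun a : ℂ => (((rho a : ℝ) : ℂ))⁻¹ - (((rho a₀ : ℝ) : ℂ))⁻¹) =O[nhds a₀]
      fun a => a - a₀ := by
  have hρ := rho_pos h₁
  have hd : DifferentiableAt ℝ (fun a : ℂ => (((rho a : ℝ) : ℂ))⁻¹) a₀ := by
    have hr : DifferentiableAt ℝ rho a₀ := by
      unfold rho
      have h2 : DifferentiableAt ℝ (fun a : ℂ => ‖a‖ ^ 2) a₀ := by
        exact (contDiff_norm_sq ℝ (n := 1)).differentiable (by simp) a₀
      refine DifferentiableAt.sqrt (by fun_prop) ?_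
      nlinarith [norm_nonneg a₀]
    have hr' : DifferentiableAt ℝ (fun a => ((rho a : ℝ) : ℂ)) a₀ :=
      Complex.ofRealCLM.differentiableAt.comp a₀ hr
    exact hr'.inv (by exact_mod_cast hρ.ne')
  exact hd.isBigO_sub

/-- A null sequence that controls `α - α₀` and `c - c₀` also controls `ρ⁻¹ c - ρ₀⁻¹ c₀`. -/
theorem isBigO_inv_rho_mul_sub {ι : Type*} {l : Filter ι} {α : ι → ℂ} {α₀ : ℂ} (h₁ : ‖α₀‖ < 1)
    {c : ι → ℂ} {c₀ : ℂ} {b : ι → ℝ} (hb : Filter.Tendsto b l (nhds 0))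
    (hα : (fun x => α x - α₀) =O[l] b) (hc : (fun x => c x - c₀) =O[l] b) :
    (fun x => (((rho (α x) : ℝ) : ℂ))⁻¹ * c x - (((rho α₀ : ℝ) : ℂ))⁻¹ * c₀) =O[l] b := by
  have htα : Filter.Tendsto α l (nhds α₀) := by
    simpa using (hα.trans_tendsto hb).add_const α₀
  have htc : Filter.Tendsto c l (nhds c₀) := by
    simpa using (hc.trans_tendsto hb).add_const c₀
  have h := ((isBigO_inv_rho_sub h₁).comp_tendsto htα).trans hα
  have hprod := h.mul (htc.isBigO_one ℝ)
  simp only [mul_one, Function.comp_apply] at hprod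
  refine (hprod.add (hc.const_mul_left (((rho α₀ : ℝ) : ℂ))⁻¹)).congr_left fun x => ?_
  ring

theorem norm_exp_ofReal_mul_I_sub_one_le (t : ℝ) : ‖Complex.exp (t * Complex.I) - 1‖ ≤ |t| := by
  simpa [mul_comm] using Real.norm_exp_I_mul_ofReal_sub_one_le (x := t)

/-- The `x`-dependent coefficients of the entries of `V_{ξ,±}`. -/
def pertCoef (α : ℤ → ℂ) (θ : ℤ → ℝ) (a₀ : ℂ) (x : ℤ) : Matrix (Fin 2) (Fin 2) ℂ :=
  (((rho (α x) : ℝ) : ℂ))⁻¹ • !![Complex.exp ((-θ x : ℝ) * Complex.I), α x;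
    (starRingEnd ℂ) (α x), Complex.exp (θ x * Complex.I)] -
  (((rho a₀ : ℝ) : ℂ))⁻¹ • !![1, a₀; (starRingEnd ℂ) a₀, 1]

/-- The `ξ`-dependent factors of the entries of `V_{ξ,±}`. -/
def pertPhase (a₀ : ℂ) (ε ξ : ℝ) : Matrix (Fin 2) (Fin 2) ℂ :=
  Complex.exp (-(((ε * ξ : ℝ) : ℂ) * Complex.I)) •
    !![Complex.exp (Complex.I * (lamOf a₀ ξ : ℂ)), 1;
      1, Complex.exp (-(Complex.I * (lamOf a₀ ξ : ℂ)))]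

theorem Vmat_apply (α : ℤ → ℂ) (θ : ℤ → ℝ) (a₀ : ℂ) (ε ξ : ℝ) (x : ℤ) (i j : Fin 2) :
    Vmat α θ a₀ ε ξ x i j = pertCoef α θ a₀ (x + 1) i j * pertPhase a₀ ε ξ i j := by
  have h1 : Complex.exp (Complex.I * ((lamOf a₀ ξ : ℂ) - θ (x + 1))) =
      Complex.exp (Complex.I * lamOf a₀ ξ) * Complex.exp ((-θ (x + 1) : ℝ) * Complex.I) := by
    rw [← Complex.exp_add]
    push_cast
    ring_nf
  have h2 : Complex.exp (-(Complex.I * ((lamOf a₀ ξ : ℂ) - θ (x + 1)))) =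
      Complex.exp (-(Complex.I * lamOf a₀ ξ)) * Complex.exp (θ (x + 1) * Complex.I) := by
    rw [← Complex.exp_add]
    ring_nf
  simp only [Vmat, Tmat, T0m, pertCoef, pertPhase, h1, h2, Matrix.smul_apply, Matrix.sub_apply,
    smul_eq_mul]
  fin_cases i <;> fin_cases j <;> simp <;> ring

theorem exists_wienerBound_pertPhase {s : ℕ} (hs : s ≤ 1) {a₀ : ℂ} (h₀ : 0 < ‖a₀‖)
    (h₁ : ‖a₀‖ < 1) (m : ℤ) (i j : Fin 2) :
    ∃ K, WienerBound s (fun ξ => pertPhase a₀ m ξ i j) K := by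
  refine ContDiff.wienerBound hs ?_ fun ξ => ?_
  · have h := contDiff_lamOf h₀ h₁
    have hc : ContDiff ℝ ∞ Complex.ofReal := Complex.ofRealCLM.contDiff
    fin_cases i <;> fin_cases j <;> simp [pertPhase] <;> fun_prop
  · have he : Complex.exp (-(((m * (ξ + 2 * Real.pi) : ℝ) : ℂ) * Complex.I)) =
        Complex.exp (-(((m * ξ : ℝ) : ℂ) * Complex.I)) := by
      rw [Complex.exp_eq_exp_iff_exists_int]
      refine ⟨-m, ?_⟩
      push_cast
      ring
    simp only [pertPhase, he, lamOf_periodic a₀ ξ]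

theorem isBigO_pertCoef {α : ℤ → ℂ} {θ : ℤ → ℝ} {a₀ : ℂ} (h₁ : ‖a₀‖ < 1) {l : Filter ℤ}
    (hb : Filter.Tendsto (fun x => ‖α x - a₀‖ + |θ x|) l (nhds 0)) (i j : Fin 2) :
    (fun x => pertCoef α θ a₀ x i j) =O[l] fun x => ‖α x - a₀‖ + |θ x| := by
  have hα : (fun x => α x - a₀) =O[l] fun x => ‖α x - a₀‖ + |θ x| :=
    .of_norm_le fun x => le_add_of_nonneg_right (abs_nonneg _)
  have hαc : (fun x => (starRingEnd ℂ) (α x) - (starRingEnd ℂ) a₀) =O[l]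
      fun x => ‖α x - a₀‖ + |θ x| :=
    .of_norm_le fun x => by
      rw [← map_sub, RCLike.norm_conj]
      exact le_add_of_nonneg_right (abs_nonneg _)
  have hexp : (fun x => Complex.exp (θ x * Complex.I) - 1) =O[l]
      fun x => ‖α x - a₀‖ + |θ x| :=
    .of_norm_le fun x =>
      (norm_exp_ofReal_mul_I_sub_one_le _).trans (le_add_of_nonneg_left (norm_nonneg _))
  have hexp' : (fun x => Complex.exp ((-θ x : ℝ) * Complex.I) - 1) =O[l]
      fun x => ‖α x - a₀‖ + |θ x| :=
    .of_norm_le fun x =>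
      (norm_exp_ofReal_mul_I_sub_one_le _).trans
        (by rw [abs_neg]; exact le_add_of_nonneg_left (norm_nonneg _))
  fin_cases i <;> fin_cases j
  · exact isBigO_inv_rho_mul_sub h₁ hb hα hexp'
  · exact isBigO_inv_rho_mul_sub h₁ hb hα hα
  · exact isBigO_inv_rho_mul_sub h₁ hb hα hαc
  · exact isBigO_inv_rho_mul_sub h₁ hb hα hexp

theorem summable_tsum_Vmat {s t : ℕ} (hs : s ≤ 1) {α : ℤ → ℂ} {θ : ℤ → ℝ} {a₀ : ℂ}
    (h₀ : 0 < ‖a₀‖) (h₁ : ‖a₀‖ < 1) (m : ℤ)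
    (hsum : Summable fun x : ℤ => jp x ^ t * (‖α x - a₀‖ + |θ x|)) :
    (∀ x : ℤ, Summable fun n : ℤ =>
        jp n ^ s * opN (fcoefM (fun ξ => Vmat α θ a₀ m ξ x) n)) ∧
      Summable fun x : ℤ => jp x ^ t *
        ∑' n : ℤ, jp n ^ s * opN (fcoefM (fun ξ => Vmat α θ a₀ m ξ x) n) := by
  choose K hK using fun i j => exists_wienerBound_pertPhase hs h₀ h₁ m i j
  have hV : ∀ x i j, WienerBound s (fun ξ => Vmat α θ a₀ m ξ x i j)
      (‖pertCoef α θ a₀ (x + 1) i j‖ * K i j) := fun x i j => by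
    simp only [Vmat_apply]
    exact (hK i j).const_mul _
  refine ⟨fun x => (summable_opN_and_tsum_le (hV x)).1, ?_⟩
  have hb0 : Filter.Tendsto (fun x => ‖α x - a₀‖ + |θ x|) Filter.cofinite (nhds 0) := by
    refine (hsum.of_nonneg_of_le (fun x => by positivity) fun x => ?_).tendsto_cofinite_zero
    exact le_mul_of_one_le_left (by positivity) (one_le_pow₀ (one_le_jp x))
  have hmaj : Summable fun x => jp x ^ t * ∑ i, ∑ j, ‖pertCoef α θ a₀ x i j‖ * K i j := by
    refine summable_of_isBigO hsum (IsBigO.mul (isBigO_refl _ _) ?_)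
    refine IsBigO.fun_sum fun i _ => IsBigO.fun_sum fun j _ => ?_
    simp only [mul_comm _ (K i j)]
    exact (isBigO_pertCoef (l := Filter.cofinite) h₁ hb0 i j).norm_left.const_mul_left _
  refine (((Equiv.addRight (1 : ℤ)).summable_iff.2 hmaj).mul_left
    (2 ^ t * jp (-1) ^ t)).of_nonneg_of_le (fun x => ?_) fun x => ?_
  · exact mul_nonneg (jp_pow_nonneg t x) (tsum_nonneg fun n =>
      mul_nonneg (jp_pow_nonneg s n) (norm_nonneg _))
  · have h1 := jp_add_pow_le (s := t) (x + 1) (-1)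
    rw [add_neg_cancel_right] at h1
    have h2 := (summable_opN_and_tsum_le (hV x)).2
    have h3 : 0 ≤ ∑ i, ∑ j, ‖pertCoef α θ a₀ (x + 1) i j‖ * K i j :=
      Finset.sum_nonneg fun i _ => Finset.sum_nonneg fun j _ => (hV x i j).nonneg
    refine (mul_le_mul_of_nonneg_left h2 (jp_pow_nonneg t x)).trans ?_
    refine (mul_le_mul_of_nonneg_right h1 h3).trans_eq ?_
    simp only [Function.comp_apply, Equiv.coe_addRight]
    ring

end Perturbation

/-- Wiener-algebra-type bounds: (i) the Fourier coefficients of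
`ξ ↦ A_{ξ,±}^x` satisfy `Σ_n ⟨n⟩^{σ−1}‖·‖ ≤ C⟨x⟩^σ` for `∓x ≥ 0`; (ii) under an `l^{1,σ}`
perturbation, `Σ_x ⟨x⟩^σ Σ_n ⟨n⟩^{σ−1}‖(V_{·,±}(x))^∧(n)‖ < ∞`. -/
theorem stmt12 (σ : ℕ) (hσ : σ = 1 ∨ σ = 2)
    (α₀ : ℂ) (h₀ : 0 < ‖α₀‖) (h₁ : ‖α₀‖ < 1)
    (α : ℤ → ℂ) (θ : ℤ → ℝ) (hα : ∀ x : ℤ, ‖α x‖ < 1) :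
    (∃ C : ℝ, 0 < C ∧
      (∀ x : ℤ, x ≤ 0 →
        Summable (fun n : ℤ =>
          jp n ^ (σ - 1) * opN (fcoefM (fun ξ => mzpow (Amat α₀ 1 ξ) x) n)) ∧
        (∑' n : ℤ, jp n ^ (σ - 1) * opN (fcoefM (fun ξ => mzpow (Amat α₀ 1 ξ) x) n))
          ≤ C * jp x ^ σ) ∧
      (∀ x : ℤ, 0 ≤ x →
        Summable (fun n : ℤ =>
          jp n ^ (σ - 1) * opN (fcoefM (fun ξ => mzpow (Amat α₀ (-1) ξ) x) n)) ∧
        (∑' n : ℤ, jp n ^ (σ - 1) * opN (fcoefM (fun ξ => mzpow (Amat α₀ (-1) ξ) x) n))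
          ≤ C * jp x ^ σ)) ∧
    ((Summable fun x : ℤ => jp x ^ σ * (‖α x - α₀‖ + |θ x|)) →
      (∀ x : ℤ, Summable fun n : ℤ =>
          jp n ^ (σ - 1) * opN (fcoefM (fun ξ => Vmat α θ α₀ 1 ξ x) n)) ∧
      Summable (fun x : ℤ => jp x ^ σ *
          ∑' n : ℤ, jp n ^ (σ - 1) * opN (fcoefM (fun ξ => Vmat α θ α₀ 1 ξ x) n)) ∧
      (∀ x : ℤ, Summable fun n : ℤ =>
          jp n ^ (σ - 1) * opN (fcoefM (fun ξ => Vmat α θ α₀ (-1) ξ x) n)) ∧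
      Summable (fun x : ℤ => jp x ^ σ *
          ∑' n : ℤ, jp n ^ (σ - 1) * opN (fcoefM (fun ξ => Vmat α θ α₀ (-1) ξ x) n))) := by
  obtain ⟨s, rfl, hs⟩ : ∃ s, σ = s + 1 ∧ s ≤ 1 := by
    rcases hσ with rfl | rfl
    exacts [⟨0, rfl, zero_le_one⟩, ⟨1, rfl, le_rfl⟩]
  simp only [Nat.add_sub_cancel]
  refine ⟨?_, fun hsum => ?_⟩
  · have hper : Function.Periodic (fun ξ => T0m α₀ (lamOf α₀ ξ)) (2 * Real.pi) := fun ξ => by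
      simp only [lamOf_periodic α₀ ξ]
    have hT := contDiff_T0m h₀ h₁
    have htr := trace_T0m_lamOf h₀ h₁
    obtain ⟨C, hC, hpow⟩ := exists_tsum_pow_le hs hT hper (fun ξ => det_T0m h₁ _) htr
    obtain ⟨C', hC', hpow'⟩ := exists_tsum_pow_le hs
      (M := fun ξ => (T0m α₀ (lamOf α₀ ξ)).adjugate)
      (fun i j => by
        simp only [Matrix.adjugate_fin_two]
        fin_cases i <;> fin_cases j
        exacts [hT 1 1, (hT 0 1).neg, (hT 1 0).neg, hT 0 0])
      (fun ξ => by simp only [lamOf_periodic α₀ ξ])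
      (fun ξ => by rw [Matrix.det_adjugate, det_T0m h₁, one_pow])
      (fun ξ => by
        rw [← htr, Matrix.adjugate_fin_two, Matrix.trace_fin_two_of, Matrix.trace_fin_two,
          add_comm])
    refine ⟨C + C', by positivity, fun x hx => ?_, fun x hx => ?_⟩
    · obtain ⟨N, rfl⟩ : ∃ N : ℕ, x = -N := ⟨x.natAbs, by omega⟩
      have hz : ∀ ξ, mzpow (Amat α₀ 1 ξ) (-N) =
          (Complex.exp (ξ * Complex.I) • (T0m α₀ (lamOf α₀ ξ)).adjugate) ^ N := by
        intro ξ
        rw [← inv_Amat_one h₁]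
        unfold mzpow
        split_ifs with h
        · obtain rfl : N = 0 := by omega
          simp
        · simp
      have hj : jp (-N) = jp N := by simp [jp]
      simp only [hz, hj]
      refine ⟨(hpow' N).1, (hpow' N).2.trans ?_⟩
      exact mul_le_mul_of_nonneg_right (by linarith) (jp_pow_nonneg _ _)
    · lift x to ℕ using hx with N
      have hz : ∀ ξ, mzpow (Amat α₀ (-1) ξ) N =
          (Complex.exp (ξ * Complex.I) • T0m α₀ (lamOf α₀ ξ)) ^ N := by
        intro ξ
        rw [← Amat_neg_one]
        simp [mzpow]
      simp only [hz]
      refine ⟨(hpow N).1, (hpow N).2.trans ?_⟩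
      exact mul_le_mul_of_nonneg_right (by linarith) (jp_pow_nonneg _ _)
  · obtain ⟨h1, h2⟩ := summable_tsum_Vmat hs h₀ h₁ 1 hsum
    obtain ⟨h3, h4⟩ := summable_tsum_Vmat hs h₀ h₁ (-1) hsum
    push_cast at h1 h2 h3 h4
    exact ⟨h1, h2, h3, h4⟩
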